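/- Let S be a finite nonempty type, γ ∈ [0,1), R_max ≥ 0, r : S → ℝ with |r s| ≤ R_max for all s, μ : PMF S, and let P, P' : S → PMF S be two transition kernels. If the visitation-averaged modeling error satisfies ∑_s ρ_{μ,P}(s) · KL(P s ‖ P' s) ≤ ε for some ε ≥ 0, then |J(μ, P) − J(μ, P')| ≤ 2·γ·R_max·√ε / (1−γ)². -/

import Mathlib

open scoped ENNReal

/-- The `t`-fold bind iterate of an initial distribution `μ` under transition kernel `P`:
`μ_0 = μ`, `μ_{t+1} = μ_t.bind P`. -/
noncomputable def stepDist {S : Type*} (P : S → PMF S) (μ : PMF S) : ℕ → PMF S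
  | 0 => μ
  | (t + 1) => (stepDist P μ t).bind P

/-- Discounted value `J(μ, P) = ∑'_t γ^t ∑_s μ_t^P(s) · r(s)`. -/
noncomputable def discValue {S : Type*} [Fintype S] (γ : ℝ) (r : S → ℝ)
    (μ : PMF S) (P : S → PMF S) : ℝ :=
  ∑' t : ℕ, γ ^ t * ∑ s, (stepDist P μ t s).toReal * r s

/-- Discounted visitation distribution `ρ_{μ,P}(s) = (1−γ) ∑'_t γ^t μ_t^P(s)`. -/
noncomputable def visitDist {S : Type*} (γ : ℝ) (μ : PMF S) (P : S → PMF S) (s : S) : ℝ :=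
  (1 - γ) * ∑' t : ℕ, γ ^ t * (stepDist P μ t s).toReal

/-- Kullback–Leibler divergence `KL(p‖q) = ∑_s p s · log(p s / q s)` on a finite type,
with the conventions `0·log(0/q) = 0` and `KL(p‖q) = ∞` if `p` is not absolutely
continuous with respect to `q`. -/
noncomputable def klDivPMF {S : Type*} [Fintype S] (p q : PMF S) : ℝ≥0∞ :=
  if ∀ s, q s = 0 → p s = 0 then
    ENNReal.ofReal (∑ s, (p s).toReal * Real.log ((p s).toReal / (q s).toReal))
  else ⊤

theorem PMF.sum_toReal {S : Type*} [Fintype S] (p : PMF S) : ∑ s, (p s).toReal = 1 := by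
  rw [← ENNReal.toReal_sum fun s _ => p.apply_ne_top s, ← tsum_fintype (L := .unconditional S),
    p.tsum_coe, ENNReal.toReal_one]

theorem PMF.toReal_le_one {S : Type*} (p : PMF S) (s : S) : (p s).toReal ≤ 1 :=
  ENNReal.toReal_le_of_le_ofReal zero_le_one (by simpa using p.coe_le_one s)

theorem PMF.toReal_bind_apply {S T : Type*} [Fintype S] (p : PMF S) (f : S → PMF T) (t : T) :
    (p.bind f t).toReal = ∑ s, (p s).toReal * (f s t).toReal := by
  rw [PMF.bind_apply, tsum_fintype, ENNReal.toReal_sum fun s _ =>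
    ENNReal.mul_ne_top (p.apply_ne_top s) ((f s).apply_ne_top t)]
  simp only [ENNReal.toReal_mul]

/-- The `ℓ¹` distance between two probability mass functions on a finite type. -/
noncomputable def pmfL1Dist {S : Type*} [Fintype S] (p q : PMF S) : ℝ :=
  ∑ s, |(p s).toReal - (q s).toReal|

theorem pmfL1Dist_nonneg {S : Type*} [Fintype S] (p q : PMF S) : 0 ≤ pmfL1Dist p q :=
  Finset.sum_nonneg fun _ _ => abs_nonneg _

theorem pmfL1Dist_le_two {S : Type*} [Fintype S] (p q : PMF S) : pmfL1Dist p q ≤ 2 := by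
  calc pmfL1Dist p q ≤ ∑ s, ((p s).toReal + (q s).toReal) := by
        refine Finset.sum_le_sum fun s _ => ?_
        have hp : 0 ≤ (p s).toReal := ENNReal.toReal_nonneg
        have hq : 0 ≤ (q s).toReal := ENNReal.toReal_nonneg
        exact abs_le.2 ⟨by linarith, by linarith⟩
    _ = 2 := by rw [Finset.sum_add_distrib, p.sum_toReal, q.sum_toReal]; norm_num

theorem two_mul_sub_two_mul_sqrt_le_mul_log {p q : ℝ} (hp : 0 ≤ p) (hq : 0 ≤ q)
    (h : q = 0 → p = 0) : 2 * p - 2 * (√p * √q) ≤ p * Real.log (p / q) := by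
  rcases hp.eq_or_lt with rfl | hp
  · simp
  have hq : 0 < q := hq.lt_of_ne fun h0 => hp.ne' (h h0.symm)
  have ha := Real.sqrt_pos.2 hp
  have hb := Real.sqrt_pos.2 hq
  have hlog : Real.log (p / q) = -(2 * Real.log (√q / √p)) := by
    rw [Real.log_div hp.ne' hq.ne', Real.log_div hb.ne' ha.ne', Real.log_sqrt hp.le,
      Real.log_sqrt hq.le]
    ring
  have hle := Real.log_le_sub_one_of_pos (div_pos hb ha)
  have hmul : p * (√q / √p) = √p * √q := by
    nth_rewrite 1 [← Real.mul_self_sqrt hp.le]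
    field_simp
  rw [hlog]
  nlinarith [mul_le_mul_of_nonneg_left hle hp.le]

/-- A weak form of Pinsker's inequality, proved through the Hellinger distance. -/
theorem pmfL1Dist_sq_le {S : Type*} [Fintype S] (p q : PMF S) (h : ∀ s, q s = 0 → p s = 0) :
    pmfL1Dist p q ^ 2 ≤ 4 * ∑ s, (p s).toReal * Real.log ((p s).toReal / (q s).toReal) := by
  have hsq : ∀ (f : PMF S) (s : S), √(f s).toReal ^ 2 = (f s).toReal := fun f s =>
    Real.sq_sqrt ENNReal.toReal_nonneg
  have hfactor : pmfL1Dist p q =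
      ∑ s, |√(p s).toReal - √(q s).toReal| * (√(p s).toReal + √(q s).toReal) := by
    refine Finset.sum_congr rfl fun s _ => ?_
    have hadd : 0 ≤ √(p s).toReal + √(q s).toReal := by positivity
    have hdiff : (p s).toReal - (q s).toReal =
        (√(p s).toReal - √(q s).toReal) * (√(p s).toReal + √(q s).toReal) := by
      linear_combination -hsq p s + hsq q s
    rw [hdiff, abs_mul, abs_of_nonneg hadd]
  have hsum : ∑ s, (√(p s).toReal + √(q s).toReal) ^ 2 ≤ 4 := by
    calc _ ≤ ∑ s, (2 * (p s).toReal + 2 * (q s).toReal) := by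
          refine Finset.sum_le_sum fun s _ => ?_
          nlinarith [hsq p s, hsq q s, sq_nonneg (√(p s).toReal - √(q s).toReal)]
      _ = 4 := by
          rw [Finset.sum_add_distrib, ← Finset.mul_sum, ← Finset.mul_sum, p.sum_toReal,
            q.sum_toReal]
          norm_num
  have hhell : ∑ s, |√(p s).toReal - √(q s).toReal| ^ 2 ≤
      ∑ s, (p s).toReal * Real.log ((p s).toReal / (q s).toReal) := by
    calc _ = ∑ s, ((p s).toReal + (q s).toReal - 2 * (√(p s).toReal * √(q s).toReal)) := by
          refine Finset.sum_congr rfl fun s _ => ?_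
          rw [sq_abs, sub_sq, hsq, hsq]
          ring
      _ = ∑ s, (2 * (p s).toReal - 2 * (√(p s).toReal * √(q s).toReal)) := by
          simp only [Finset.sum_sub_distrib, Finset.sum_add_distrib, ← Finset.mul_sum,
            p.sum_toReal, q.sum_toReal]
          norm_num
      _ ≤ _ := by
          refine Finset.sum_le_sum fun s _ => ?_
          refine two_mul_sub_two_mul_sqrt_le_mul_log ENNReal.toReal_nonneg
            ENNReal.toReal_nonneg fun h0 => ?_
          have hq0 : q s = 0 := (ENNReal.toReal_eq_zero_iff _).1 h0 |>.resolve_right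
            (q.apply_ne_top s)
          simp [h s hq0]
  have hcs := Finset.sum_mul_sq_le_sq_mul_sq Finset.univ
    (fun s => |√(p s).toReal - √(q s).toReal|) (fun s => √(p s).toReal + √(q s).toReal)
  rw [hfactor]
  have hnonneg : 0 ≤ ∑ s, |√(p s).toReal - √(q s).toReal| ^ 2 :=
    Finset.sum_nonneg fun _ _ => sq_nonneg _
  nlinarith [mul_le_mul_of_nonneg_left hsum hnonneg]

theorem ofReal_pmfL1Dist_sq_le {S : Type*} [Fintype S] (p q : PMF S) :
    ENNReal.ofReal (pmfL1Dist p q ^ 2) ≤ 4 * klDivPMF p q := by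
  unfold klDivPMF
  split_ifs with h
  · rw [show (4 : ℝ≥0∞) = ENNReal.ofReal 4 by simp, ← ENNReal.ofReal_mul (by norm_num)]
    exact ENNReal.ofReal_le_ofReal (pmfL1Dist_sq_le p q h)
  · simp

theorem pmfL1Dist_bind_le {S : Type*} [Fintype S] (p q : PMF S) (P P' : S → PMF S) :
    pmfL1Dist (p.bind P) (q.bind P') ≤
      pmfL1Dist p q + ∑ s, (p s).toReal * pmfL1Dist (P s) (P' s) := by
  calc pmfL1Dist (p.bind P) (q.bind P')
      ≤ ∑ t, ∑ s, (|(p s).toReal - (q s).toReal| * (P' s t).toReal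
          + (p s).toReal * |(P s t).toReal - (P' s t).toReal|) := by
        refine Finset.sum_le_sum fun t _ => ?_
        rw [PMF.toReal_bind_apply, PMF.toReal_bind_apply, ← Finset.sum_sub_distrib]
        refine (Finset.abs_sum_le_sum_abs _ _).trans (Finset.sum_le_sum fun s _ => ?_)
        have hp : 0 ≤ (p s).toReal := ENNReal.toReal_nonneg
        have hP' : 0 ≤ (P' s t).toReal := ENNReal.toReal_nonneg
        rw [← abs_of_nonneg hP', ← abs_of_nonneg hp, ← abs_mul, ← abs_mul]
        simp only [abs_of_nonneg hP', abs_of_nonneg hp]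
        refine (le_of_eq (congrArg _ ?_)).trans (abs_add_le _ _)
        ring
    _ = _ := by
        rw [Finset.sum_comm]
        simp only [Finset.sum_add_distrib, ← Finset.mul_sum, PMF.sum_toReal, mul_one, pmfL1Dist]

theorem summable_pow_mul_of_bounded {γ : ℝ} (hγ0 : 0 ≤ γ) (hγ1 : γ < 1) {f : ℕ → ℝ} {C : ℝ}
    (hf : ∀ t, |f t| ≤ C) : Summable fun t => γ ^ t * f t := by
  refine Summable.of_norm_bounded ((summable_geometric_of_lt_one hγ0 hγ1).mul_right C) fun t => ?_
  rw [Real.norm_eq_abs, abs_mul, abs_of_nonneg (pow_nonneg hγ0 t)]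
  exact mul_le_mul_of_nonneg_left (hf t) (pow_nonneg hγ0 t)

theorem summable_pow_mul_stepDist {S : Type*} {γ : ℝ} (hγ0 : 0 ≤ γ) (hγ1 : γ < 1)
    (μ : PMF S) (P : S → PMF S) (s : S) :
    Summable fun t => γ ^ t * (stepDist P μ t s).toReal :=
  summable_pow_mul_of_bounded hγ0 hγ1 (C := 1) fun t => by
    rw [abs_of_nonneg ENNReal.toReal_nonneg]
    exact (stepDist P μ t).toReal_le_one s

theorem visitDist_nonneg {S : Type*} {γ : ℝ} (hγ0 : 0 ≤ γ) (hγ1 : γ < 1)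
    (μ : PMF S) (P : S → PMF S) (s : S) : 0 ≤ visitDist γ μ P s :=
  mul_nonneg (sub_nonneg.2 hγ1.le)
    (tsum_nonneg fun t => mul_nonneg (pow_nonneg hγ0 t) ENNReal.toReal_nonneg)

theorem sum_visitDist_mul {S : Type*} [Fintype S] {γ : ℝ} (hγ0 : 0 ≤ γ) (hγ1 : γ < 1)
    (μ : PMF S) (P : S → PMF S) (w : S → ℝ) :
    ∑ s, visitDist γ μ P s * w s =
      (1 - γ) * ∑' t : ℕ, γ ^ t * ∑ s, (stepDist P μ t s).toReal * w s := by
  simp only [Finset.mul_sum, ← mul_assoc]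
  rw [Summable.tsum_finsetSum fun s _ =>
    (summable_pow_mul_stepDist hγ0 hγ1 μ P s).mul_right (w s), Finset.mul_sum]
  refine Finset.sum_congr rfl fun s _ => ?_
  rw [tsum_mul_right, visitDist, mul_assoc]

theorem sum_visitDist {S : Type*} [Fintype S] {γ : ℝ} (hγ0 : 0 ≤ γ) (hγ1 : γ < 1)
    (μ : PMF S) (P : S → PMF S) : ∑ s, visitDist γ μ P s = 1 := by
  have h := sum_visitDist_mul hγ0 hγ1 μ P fun _ => 1
  simp only [mul_one, PMF.sum_toReal] at h
  rw [h, tsum_geometric_of_lt_one hγ0 hγ1, mul_inv_cancel₀ (sub_pos.2 hγ1).ne']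

theorem abs_sum_toReal_mul_sub_le {S : Type*} [Fintype S] (p q : PMF S) {r : S → ℝ} {R : ℝ}
    (hr : ∀ s, |r s| ≤ R) :
    |∑ s, (p s).toReal * r s - ∑ s, (q s).toReal * r s| ≤ R * pmfL1Dist p q := by
  rw [← Finset.sum_sub_distrib, pmfL1Dist, Finset.mul_sum]
  refine (Finset.abs_sum_le_sum_abs _ _).trans (Finset.sum_le_sum fun s _ => ?_)
  rw [← sub_mul, abs_mul, mul_comm]
  exact mul_le_mul_of_nonneg_right (hr s) (abs_nonneg _)

theorem abs_sum_toReal_mul_le {S : Type*} [Fintype S] (p : PMF S) {r : S → ℝ} {R : ℝ}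
    (hr : ∀ s, |r s| ≤ R) : |∑ s, (p s).toReal * r s| ≤ R := by
  calc _ ≤ ∑ s, |(p s).toReal * r s| := Finset.abs_sum_le_sum_abs _ _
    _ ≤ ∑ s, (p s).toReal * R := by
        refine Finset.sum_le_sum fun s _ => ?_
        rw [abs_mul, abs_of_nonneg ENNReal.toReal_nonneg]
        exact mul_le_mul_of_nonneg_left (hr s) ENNReal.toReal_nonneg
    _ = R := by rw [← Finset.sum_mul, p.sum_toReal, one_mul]

theorem tsum_pow_mul_pmfL1Dist_le {S : Type*} [Fintype S] {γ : ℝ} (hγ0 : 0 ≤ γ) (hγ1 : γ < 1)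
    (μ : PMF S) (P P' : S → PMF S) :
    ∑' t : ℕ, γ ^ t * pmfL1Dist (stepDist P μ t) (stepDist P' μ t) ≤
      γ / (1 - γ) ^ 2 * ∑ s, visitDist γ μ P s * pmfL1Dist (P s) (P' s) := by
  set D : ℕ → ℝ := fun t => pmfL1Dist (stepDist P μ t) (stepDist P' μ t) with hD
  set e : ℕ → ℝ := fun t => ∑ s, (stepDist P μ t s).toReal * pmfL1Dist (P s) (P' s)
  have hDs : ∀ k, Summable fun t => γ ^ t * D (t + k) := fun _ =>
    summable_pow_mul_of_bounded hγ0 hγ1 (C := 2) fun t => by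
      rw [abs_of_nonneg (pmfL1Dist_nonneg _ _)]
      exact pmfL1Dist_le_two _ _
  have hD0 : Summable fun t => γ ^ t * D t := hDs 0
  have hes : Summable fun t => γ ^ t * e t :=
    summable_pow_mul_of_bounded hγ0 hγ1 (C := 2) fun t => abs_sum_toReal_mul_le _ fun s => by
      rw [abs_of_nonneg (pmfL1Dist_nonneg _ _)]
      exact pmfL1Dist_le_two _ _
  have hshift : ∑' t, γ ^ t * D t = γ * ∑' t, γ ^ t * D (t + 1) := by
    rw [hD0.tsum_eq_zero_add, ← tsum_mul_left]
    simp [hD, stepDist, pmfL1Dist, pow_succ', mul_assoc]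
  have hle : ∑' t, γ ^ t * D (t + 1) ≤ ∑' t, γ ^ t * D t + ∑' t, γ ^ t * e t := by
    rw [← hD0.tsum_add hes]
    refine (hDs 1).tsum_le_tsum (fun t => ?_) (hD0.add hes)
    rw [← mul_add]
    exact mul_le_mul_of_nonneg_left (pmfL1Dist_bind_le _ _ _ _) (pow_nonneg hγ0 t)
  have hpos : 0 < 1 - γ := sub_pos.2 hγ1
  rw [sum_visitDist_mul hγ0 hγ1]
  have hrhs : γ / (1 - γ) ^ 2 * ((1 - γ) * ∑' t, γ ^ t * e t) =
      γ * (∑' t, γ ^ t * e t) / (1 - γ) := by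
    field_simp
  rw [hrhs, le_div_iff₀ hpos]
  nlinarith [mul_le_mul_of_nonneg_left hle hγ0]

/-- The simulation lemma weighted by the visitation distribution. -/
theorem abs_discValue_sub_le {S : Type*} [Fintype S] {γ : ℝ} (hγ0 : 0 ≤ γ) (hγ1 : γ < 1)
    {R : ℝ} (hR : 0 ≤ R) {r : S → ℝ} (hr : ∀ s, |r s| ≤ R) (μ : PMF S) (P P' : S → PMF S) :
    |discValue γ r μ P - discValue γ r μ P'| ≤
      R * (γ / (1 - γ) ^ 2 * ∑ s, visitDist γ μ P s * pmfL1Dist (P s) (P' s)) := by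
  have hsum : ∀ Q : S → PMF S, Summable fun t => γ ^ t * ∑ s, (stepDist Q μ t s).toReal * r s :=
    fun Q => summable_pow_mul_of_bounded hγ0 hγ1 fun t => abs_sum_toReal_mul_le _ hr
  have hD : Summable fun t => γ ^ t * pmfL1Dist (stepDist P μ t) (stepDist P' μ t) :=
    summable_pow_mul_of_bounded hγ0 hγ1 (C := 2) fun t => by
      rw [abs_of_nonneg (pmfL1Dist_nonneg _ _)]
      exact pmfL1Dist_le_two _ _
  refine le_trans ?_ (mul_le_mul_of_nonneg_left (tsum_pow_mul_pmfL1Dist_le hγ0 hγ1 μ P P') hR)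
  rw [discValue, discValue, ← (hsum P).tsum_sub (hsum P'), ← tsum_mul_left, ← Real.norm_eq_abs]
  refine tsum_of_norm_bounded (hD.mul_left R).hasSum fun t => ?_
  rw [← mul_sub, Real.norm_eq_abs, abs_mul, abs_of_nonneg (pow_nonneg hγ0 t), mul_left_comm]
  exact mul_le_mul_of_nonneg_left (abs_sum_toReal_mul_sub_le _ _ hr) (pow_nonneg hγ0 t)

theorem sum_visitDist_mul_pmfL1Dist_le {S : Type*} [Fintype S] {γ : ℝ} (hγ0 : 0 ≤ γ)
    (hγ1 : γ < 1) (μ : PMF S) (P P' : S → PMF S) {ε : ℝ} (hε : 0 ≤ ε)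
    (hKL : ∑ s, ENNReal.ofReal (visitDist γ μ P s) * klDivPMF (P s) (P' s) ≤
      ENNReal.ofReal ε) :
    ∑ s, visitDist γ μ P s * pmfL1Dist (P s) (P' s) ≤ 2 * √ε := by
  have hρ := visitDist_nonneg hγ0 hγ1 μ P
  have hsq : ∑ s, visitDist γ μ P s * pmfL1Dist (P s) (P' s) ^ 2 ≤ 4 * ε := by
    rw [← ENNReal.ofReal_le_ofReal_iff (by positivity), ENNReal.ofReal_sum_of_nonneg
      fun s _ => mul_nonneg (hρ s) (sq_nonneg _), ENNReal.ofReal_mul (by norm_num)]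
    calc _ ≤ ∑ s, 4 * (ENNReal.ofReal (visitDist γ μ P s) * klDivPMF (P s) (P' s)) := by
          refine Finset.sum_le_sum fun s _ => ?_
          rw [ENNReal.ofReal_mul (hρ s), mul_left_comm]
          exact mul_le_mul_right (ofReal_pmfL1Dist_sq_le _ _) _
      _ ≤ _ := by
          rw [← Finset.mul_sum, ENNReal.ofReal_ofNat]
          exact mul_le_mul_right hKL _
  have hjensen : (∑ s, visitDist γ μ P s * pmfL1Dist (P s) (P' s)) ^ 2 ≤
      ∑ s, visitDist γ μ P s * pmfL1Dist (P s) (P' s) ^ 2 :=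
    Real.pow_arith_mean_le_arith_mean_pow _ _ _ (fun s _ => hρ s) (sum_visitDist hγ0 hγ1 μ P)
      (fun s _ => pmfL1Dist_nonneg _ _) 2
  refine abs_le_of_sq_le_sq' ?_ (by positivity) |>.2
  rw [mul_pow, Real.sq_sqrt hε]
  linarith

/-- KL version of the simulation lemma: if the visitation-averaged modeling error is at most
`ε`, then `|J(μ, P) − J(μ, P')| ≤ 2·γ·R_max·√ε / (1−γ)²`. -/
theorem kl_simulation_lemma {S : Type*} [Fintype S] [Nonempty S]
    (γ : ℝ) (hγ0 : 0 ≤ γ) (hγ1 : γ < 1)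
    (Rmax : ℝ) (hR : 0 ≤ Rmax) (r : S → ℝ) (hr : ∀ s, |r s| ≤ Rmax)
    (μ : PMF S) (P P' : S → PMF S) (ε : ℝ) (hε : 0 ≤ ε)
    (hKL : ∑ s, ENNReal.ofReal (visitDist γ μ P s) * klDivPMF (P s) (P' s) ≤
      ENNReal.ofReal ε) :
    |discValue γ r μ P - discValue γ r μ P'| ≤
      2 * γ * Rmax * Real.sqrt ε / (1 - γ) ^ 2 := by
  refine (abs_discValue_sub_le hγ0 hγ1 hR hr μ P P').trans ?_
  have hle := sum_visitDist_mul_pmfL1Dist_le hγ0 hγ1 μ P P' hε hKL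
  have hc : 0 ≤ γ / (1 - γ) ^ 2 := by positivity
  calc _ ≤ Rmax * (γ / (1 - γ) ^ 2 * (2 * √ε)) := by gcongr
    _ = _ := by ring
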